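/- Let K be a finitely generated field of characteristic p ≥ 0, let n ≥ 2, d ≥ 2, and 1 ≤ r ≤ n be integers, and suppose that p does not divide gcd(d, n+1) (this holds automatically when p = 0). Then there exist linearly independent homogeneous polynomials F_0, …, F_r of degree d in K[x_0, …, x_n] such that the linear system ⟨F_0, …, F_r⟩ is K-smooth, i.e., for every (a_0, …, a_r) ∈ K^{r+1} \ {0}, the polynomial a_0F_0 + … + a_rF_r cuts out a smooth hypersurface in ℙ^n. -/

import Mathlib

open MvPolynomial

/-- A homogeneous polynomial `F` of degree `d` in `K[x_0, …, x_n]` cuts out a smooth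
hypersurface in `ℙ^n` if there is no point `t ≠ 0` with coordinates in an algebraic closure
of `K` at which `F` and all its partial derivatives vanish simultaneously. -/
def CutsOutSmoothHypersurface {K : Type*} [Field K] {n : ℕ}
    (F : MvPolynomial (Fin (n + 1)) K) : Prop :=
  ∀ t : Fin (n + 1) → AlgebraicClosure K, t ≠ 0 →
    ¬ (eval t (map (algebraMap K (AlgebraicClosure K)) F) = 0 ∧
       ∀ i : Fin (n + 1),
         eval t (map (algebraMap K (AlgebraicClosure K)) (pderiv i F)) = 0)

section CoefficientTrace

variable {K L E ι : Type*} [Field K] [Field L] [Field E] [Algebra K L] [Algebra K E]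

/-- The coefficientwise trace of a polynomial. -/
noncomputable def MvPolynomial.coeffTrace (P : MvPolynomial ι L) : MvPolynomial ι K :=
  ∑ m ∈ P.support, monomial m (Algebra.trace K L (coeff m P))

theorem MvPolynomial.coeff_coeffTrace (P : MvPolynomial ι L) (m : ι →₀ ℕ) :
    coeff m (coeffTrace (K := K) P) = Algebra.trace K L (coeff m P) := by
  classical
  simp only [coeffTrace, coeff_sum, coeff_monomial, Finset.sum_ite_eq']
  split_ifs with h
  · rfl
  · rw [notMem_support_iff.mp h, map_zero]

theorem MvPolynomial.IsHomogeneous.coeffTrace {P : MvPolynomial ι L} {d : ℕ}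
    (hP : P.IsHomogeneous d) : (MvPolynomial.coeffTrace (K := K) P).IsHomogeneous d := by
  intro m hm
  refine hP fun h ↦ hm ?_
  rw [coeff_coeffTrace, h, map_zero]

theorem MvPolynomial.map_coeffTrace [FiniteDimensional K L] [Algebra.IsSeparable K L]
    [IsAlgClosed E] (P : MvPolynomial ι L) :
    map (algebraMap K E) (coeffTrace (K := K) P) =
      ∑ σ : L →ₐ[K] E, map (σ : L →+* E) P := by
  ext m
  simp [coeff_sum, coeff_map, coeff_coeffTrace, trace_eq_sum_embeddings E]

theorem MvPolynomial.sum_smul_coeffTrace {κ : Type*} (s : Finset κ) (a : κ → K)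
    (P : κ → MvPolynomial ι L) :
    ∑ i ∈ s, a i • coeffTrace (K := K) (P i) =
      coeffTrace (K := K) (∑ i ∈ s, C (algebraMap K L (a i)) * P i) := by
  ext m
  simp [coeff_sum, coeff_coeffTrace, coeff_C_mul, ← Algebra.smul_def]

end CoefficientTrace

section Embeddings

variable {K L E : Type*} [Field K] [Field L] [Field E] [Algebra K L] [Algebra K E]

/-- The conjugate linear forms vanish at a singular point of the traced hypersurface, when
the form is of Fermat type. -/
theorem forall_eq_zero_of_fermat {e : ℕ} (hd : ((e + 2 : ℕ) : K) ≠ 0) {c : L} (hc : c ≠ 0)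
    (y : (L →ₐ[K] E) → E)
    (hB : ∀ σ : L →ₐ[K] E, (e + 1) * σ c * y σ ^ e * y σ + σ c * y σ ^ (e + 1) = 0) :
    ∀ σ, y σ = 0 := by
  intro σ
  have hd' : ((e : E) + 2) ≠ 0 := by
    have := (map_ne_zero (algebraMap K E)).mpr hd
    rwa [map_natCast, Nat.cast_add, Nat.cast_ofNat] at this
  have hσc : σ c ≠ 0 := (map_ne_zero σ).mpr hc
  have h : ((e : E) + 2) * σ c * y σ ^ (e + 1) = 0 := by
    rw [← hB σ]; ring
  simpa [hd', hσc] using h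

variable [FiniteDimensional K L]

theorem eq_zero_of_forall_sum_mul_embedding_basis_eq_zero {n : ℕ}
    (b : Module.Basis (Fin (n + 1)) K L) (z : (L →ₐ[K] E) → E)
    (h : ∀ m, ∑ σ, z σ * σ (b m) = 0) : z = 0 := by
  have hsum : ∑ σ : L →ₐ[K] E, z σ • σ.toLinearMap = 0 := by
    refine b.ext fun m ↦ ?_
    simpa using h m
  have hli : LinearIndependent E (fun σ : L →ₐ[K] E ↦ σ.toLinearMap) :=
    linearIndependent_toLinearMap K L E
  exact funext (Fintype.linearIndependent_iff.mp hli z hsum)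

variable [Algebra.IsSeparable K L] [IsAlgClosed E]

theorem exists_embeddings_equiv {n : ℕ} (hdim : Module.finrank K L = n + 1) :
    Nonempty (Fin (n + 1) ≃ (L →ₐ[K] E)) :=
  ⟨Fintype.equivOfCardEq (by rw [Fintype.card_fin, AlgHom.card, hdim])⟩

theorem eq_zero_of_sum_embeddings_basis_mul_eq_zero {n : ℕ}
    (b : Module.Basis (Fin (n + 1)) K L) (t : Fin (n + 1) → E)
    (h : ∀ σ : L →ₐ[K] E, ∑ m, σ (b m) * t m = 0) : t = 0 := by
  obtain ⟨e⟩ := exists_embeddings_equiv (K := K) (L := L) (E := E)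
    (by rw [Module.finrank_eq_card_basis b, Fintype.card_fin])
  by_contra ht
  have hdet := Matrix.exists_vecMul_eq_zero_iff.mp ⟨t, ht,
    show Matrix.vecMul t (Algebra.embeddingsMatrixReindex K E b e) = 0 by
      ext j
      simpa [Matrix.vecMul, dotProduct, Algebra.embeddingsMatrixReindex,
        Algebra.embeddingsMatrix, mul_comm] using h (e j)⟩
  have := Algebra.discr_eq_det_embeddingsMatrixReindex_pow_two K E b e
  rw [hdet, zero_pow two_ne_zero, map_eq_zero] at this
  exact Algebra.discr_not_zero_of_basis K b this

theorem forall_embedding_of_orderOf_eq_finrank (g : L ≃ₐ[K] L)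
    (hg : orderOf g = Module.finrank K L) {Q : (L →ₐ[K] E) → Prop} (σ₀ : L →ₐ[K] E)
    (h₀ : Q σ₀) (hQ : ∀ σ, Q σ → Q (σ.comp (g : L →ₐ[K] L))) (σ : L →ₐ[K] E) : Q σ := by
  have hpow : ∀ k : ℕ, Q (σ₀.comp ((g ^ k : L ≃ₐ[K] L) : L →ₐ[K] L)) := fun k ↦ by
    induction k with
    | zero => exact h₀
    | succ k ih => rw [pow_succ]; exact hQ _ ih
  have hbij : Function.Bijective
      (fun k : Fin (orderOf g) ↦ σ₀.comp ((g ^ (k : ℕ) : L ≃ₐ[K] L) : L →ₐ[K] L)) := by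
    rw [Fintype.bijective_iff_injective_and_card]
    refine ⟨fun i j hij ↦ Fin.ext (pow_injOn_Iio_orderOf i.2 j.2 ?_), ?_⟩
    · ext x
      exact σ₀.injective (DFunLike.congr_fun hij x)
    · rw [Fintype.card_fin, AlgHom.card, hg]
  obtain ⟨k, rfl⟩ := hbij.2 σ
  exact hpow k

/-- The conjugate linear forms vanish at a singular point of the traced hypersurface, when
the form is of Klein type. -/
theorem forall_eq_zero_of_klein {e : ℕ} (hd : ((e + 2 : ℕ) : K) = 0)
    (hdim : ((Module.finrank K L : ℕ) : K) ≠ 0) (τ : L ≃ₐ[K] L)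
    (hτ : orderOf τ = Module.finrank K L) {c : L} (hc : c ≠ 0) (y : (L →ₐ[K] E) → E)
    (hF : ∑ σ : L →ₐ[K] E, σ c * y σ ^ (e + 1) * y (σ.comp (τ : L →ₐ[K] L)) = 0)
    (hB : ∀ σ : L →ₐ[K] E, (e + 1) * σ (τ c) * y (σ.comp (τ : L →ₐ[K] L)) ^ e *
        y ((σ.comp (τ : L →ₐ[K] L)).comp (τ : L →ₐ[K] L)) +
      σ c * y σ ^ (e + 1) = 0) :
    ∀ σ, y σ = 0 := by
  have hd' : (e : E) + 1 = -1 := by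
    have h := congrArg (algebraMap K E) hd
    simp only [map_natCast, map_zero] at h
    push_cast at h
    linear_combination h
  have hσc : ∀ σ : L →ₐ[K] E, σ c ≠ 0 := fun σ ↦ (map_ne_zero σ).mpr hc
  have hστc : ∀ σ : L →ₐ[K] E, σ (τ c) ≠ 0 := fun σ ↦ by simpa using hc
  have hB' : ∀ σ : L →ₐ[K] E,
      σ c * y σ ^ (e + 1) = σ (τ c) * y (σ.comp (τ : L →ₐ[K] L)) ^ e *
        y ((σ.comp (τ : L →ₐ[K] L)).comp (τ : L →ₐ[K] L)) := fun σ ↦ by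
    have := hB σ
    rw [hd'] at this
    linear_combination this
  let σ₀ : L →ₐ[K] E := IsAlgClosed.lift
  set T : (L →ₐ[K] E) → E := fun σ ↦ σ c * y σ ^ (e + 1) * y (σ.comp (τ : L →ₐ[K] L)) with hT
  have hTconst : ∀ σ, T σ = T σ₀ := by
    refine forall_embedding_of_orderOf_eq_finrank τ hτ σ₀ rfl fun σ h ↦ ?_
    rw [← h]
    change σ (τ c) * y (σ.comp (τ : L →ₐ[K] L)) ^ (e + 1) * _ = _
    simp only [hT, hB' σ]
    ring
  have hT₀ : T σ₀ = 0 := by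
    have h : ∑ σ, T σ = 0 := hF
    rw [Finset.sum_congr rfl fun σ _ ↦ hTconst σ, Finset.sum_const, Finset.card_univ,
      AlgHom.card, nsmul_eq_mul] at h
    refine (mul_eq_zero.mp h).resolve_left ?_
    have := (map_ne_zero (algebraMap K E)).mpr hdim
    simpa using this
  obtain ⟨σ₁, h₁⟩ : ∃ σ, y σ = 0 := by
    simp only [hT, mul_eq_zero, hσc σ₀, false_or] at hT₀
    exact hT₀.elim (fun h ↦ ⟨_, eq_zero_of_pow_eq_zero h⟩) fun h ↦ ⟨_, h⟩
  rcases Nat.eq_zero_or_pos e with rfl | he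
  · have hodd : (Module.finrank K L).Coprime 2 := by
      rw [Nat.coprime_comm, Nat.Prime.coprime_iff_not_dvd Nat.prime_two]
      rintro ⟨k, hk⟩
      refine hdim ?_
      rw [hk, Nat.cast_mul, show ((2 : ℕ) : K) = 0 from hd, zero_mul]
    refine forall_embedding_of_orderOf_eq_finrank (τ ^ 2) ?_ (Q := fun σ ↦ y σ = 0) σ₁ h₁
      fun σ h ↦ ?_
    · rw [Nat.Coprime.orderOf_pow (hτ ▸ hodd), hτ]
    · have h2 := hB' σ
      rw [h] at h2
      simp only [zero_add, pow_one, mul_zero, pow_zero, mul_one] at h2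
      have := (mul_eq_zero.mp h2.symm).resolve_left (hστc σ)
      rwa [pow_two]
  · refine forall_embedding_of_orderOf_eq_finrank τ⁻¹ (by rw [orderOf_inv, hτ])
      (Q := fun σ ↦ y σ = 0) σ₁ h₁ fun σ h ↦ ?_
    have h2 := hB' (σ.comp ((τ⁻¹ : L ≃ₐ[K] L) : L →ₐ[K] L))
    have hcomp : (σ.comp ((τ⁻¹ : L ≃ₐ[K] L) : L →ₐ[K] L)).comp (τ : L →ₐ[K] L) = σ := by
      ext x
      exact congrArg σ (τ.symm_apply_apply x)
    rw [hcomp, h, zero_pow he.ne', mul_zero, zero_mul] at h2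
    exact eq_zero_of_pow_eq_zero ((mul_eq_zero.mp h2).resolve_left (hσc _))

end Embeddings

section TracedForms

variable {K L : Type*} [Field K] [Field L] [Algebra K L] {n : ℕ}

/-- The linear form with coefficients `v`. -/
noncomputable def linearFormOf {R : Type*} [CommSemiring R] (v : Fin (n + 1) → R) :
    MvPolynomial (Fin (n + 1)) R :=
  ∑ m, C (v m) * X m

theorem isHomogeneous_linearFormOf {R : Type*} [CommSemiring R] (v : Fin (n + 1) → R) :
    (linearFormOf v).IsHomogeneous 1 :=
  IsHomogeneous.sum _ _ _ fun m _ ↦ by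
    simpa using (isHomogeneous_C (Fin (n + 1)) (v m)).mul (isHomogeneous_X R m)

theorem pderiv_linearFormOf {R : Type*} [CommSemiring R] (v : Fin (n + 1) → R)
    (i : Fin (n + 1)) : pderiv i (linearFormOf v) = C (v i) := by
  simp [linearFormOf, pderiv_X, Pi.single_apply]

theorem eval_linearFormOf {R : Type*} [CommSemiring R] (v t : Fin (n + 1) → R) :
    eval t (linearFormOf v) = ∑ m, v m * t m := by
  simp [linearFormOf]

theorem map_linearFormOf {R S : Type*} [CommSemiring R] [CommSemiring S] (f : R →+* S)
    (v : Fin (n + 1) → R) : map f (linearFormOf v) = linearFormOf fun m ↦ f (v m) := by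
  simp [linearFormOf]

/-- The form `c ℓ ^ (e + 1) τ(ℓ)` of degree `e + 2`, for `ℓ` the linear form with coefficients
`v`. -/
noncomputable def twistedPower (τ : L ≃ₐ[K] L) (v : Fin (n + 1) → L) (e : ℕ) (c : L) :
    MvPolynomial (Fin (n + 1)) L :=
  C c * (linearFormOf v ^ (e + 1) * linearFormOf fun m ↦ τ (v m))

theorem isHomogeneous_twistedPower (τ : L ≃ₐ[K] L) (v : Fin (n + 1) → L) (e : ℕ) (c : L) :
    (twistedPower τ v e c).IsHomogeneous (e + 2) := by
  have := (isHomogeneous_C (Fin (n + 1)) c).mul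
    (((isHomogeneous_linearFormOf v).pow (e + 1)).mul
      (isHomogeneous_linearFormOf fun m ↦ τ (v m)))
  rwa [show 0 + (1 * (e + 1) + 1) = e + 2 by ring] at this

variable [FiniteDimensional K L] [Algebra.IsSeparable K L]

theorem cutsOutSmoothHypersurface_coeffTrace_twistedPower
    (b : Module.Basis (Fin (n + 1)) K L) (τ : L ≃ₐ[K] L) (e : ℕ)
    (hτ : (((e + 2 : ℕ) : K) ≠ 0 ∧ τ = 1) ∨
      (((e + 2 : ℕ) : K) = 0 ∧ ((Module.finrank K L : ℕ) : K) ≠ 0 ∧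
        orderOf τ = Module.finrank K L))
    {c : L} (hc : c ≠ 0) :
    CutsOutSmoothHypersurface (coeffTrace (K := K) (twistedPower τ b e c)) := by
  rintro t ht ⟨hF, hD⟩
  set y : (L →ₐ[K] AlgebraicClosure K) → AlgebraicClosure K :=
    fun σ ↦ ∑ m, σ (b m) * t m with hy
  have hmap : ∀ σ : L →ₐ[K] AlgebraicClosure K,
      map (σ : L →+* AlgebraicClosure K) (twistedPower τ b e c) =
        C (σ c) * (linearFormOf (fun m ↦ σ (b m)) ^ (e + 1) *
          linearFormOf fun m ↦ σ (τ (b m))) := fun σ ↦ by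
    simp [twistedPower, map_linearFormOf]
  have hyτ : ∀ σ : L →ₐ[K] AlgebraicClosure K,
      y (σ.comp (τ : L →ₐ[K] L)) = ∑ m, σ (τ (b m)) * t m := fun σ ↦ rfl
  rw [map_coeffTrace, map_sum] at hF
  simp only [hmap, map_mul, map_pow, eval_C, eval_linearFormOf, ← hyτ, ← mul_assoc] at hF
  have hD' : ∀ i, ∑ σ : L →ₐ[K] AlgebraicClosure K,
      (((e : AlgebraicClosure K) + 1) * σ c * y σ ^ e * y (σ.comp (τ : L →ₐ[K] L)) * σ (b i) +
        σ c * y σ ^ (e + 1) * σ (τ (b i))) = 0 := fun i ↦ by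
    have h := hD i
    rw [← pderiv_map, map_coeffTrace, map_sum, map_sum] at h
    rw [← h]
    refine Finset.sum_congr rfl fun σ _ ↦ ?_
    rw [hmap]
    simp only [Derivation.leibniz, Derivation.leibniz_pow, pderiv_linearFormOf, pderiv_C,
      smul_eq_mul, nsmul_eq_mul, map_add, map_mul, map_pow, eval_C, eval_linearFormOf, map_natCast,
      map_zero, ← hyτ, Nat.add_sub_cancel]
    push_cast
    ring
  have hshift : ∀ i, ∑ σ : L →ₐ[K] AlgebraicClosure K, σ c * y σ ^ (e + 1) * σ (τ (b i)) =
      ∑ σ : L →ₐ[K] AlgebraicClosure K, (σ (τ.symm c) *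
        y (σ.comp (τ.symm : L →ₐ[K] L)) ^ (e + 1)) * σ (b i) := fun i ↦ by
    refine Fintype.sum_equiv (AlgEquiv.arrowCongr τ.symm AlgEquiv.refl) _ _ fun σ ↦ ?_
    have happ : ∀ x, AlgEquiv.arrowCongr τ.symm AlgEquiv.refl σ x = σ (τ x) := fun x ↦ rfl
    have hcomp : (AlgEquiv.arrowCongr τ.symm AlgEquiv.refl σ).comp (τ.symm : L →ₐ[K] L) = σ := by
      ext x
      simp [AlgEquiv.arrowCongr]
    rw [hcomp, happ, happ, τ.apply_symm_apply]
  have hB := eq_zero_of_forall_sum_mul_embedding_basis_eq_zero b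
    (fun σ : L →ₐ[K] AlgebraicClosure K ↦
      ((e : AlgebraicClosure K) + 1) * σ c * y σ ^ e * y (σ.comp (τ : L →ₐ[K] L)) +
        σ (τ.symm c) * y (σ.comp (τ.symm : L →ₐ[K] L)) ^ (e + 1))
    fun i ↦ by
      rw [← hD' i, Finset.sum_add_distrib, hshift, ← Finset.sum_add_distrib]
      exact Finset.sum_congr rfl fun σ _ ↦ add_mul _ _ _
  have hBτ : ∀ σ : L →ₐ[K] AlgebraicClosure K,
      ((e : AlgebraicClosure K) + 1) * σ (τ c) * y (σ.comp (τ : L →ₐ[K] L)) ^ e *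
        y ((σ.comp (τ : L →ₐ[K] L)).comp (τ : L →ₐ[K] L)) +
        σ c * y σ ^ (e + 1) = 0 := fun σ ↦ by
    have h := congrFun hB (σ.comp (τ : L →ₐ[K] L))
    have hcomp : (σ.comp (τ : L →ₐ[K] L)).comp (τ.symm : L →ₐ[K] L) = σ := by
      ext x; simp
    simpa [hcomp] using h
  refine ht (eq_zero_of_sum_embeddings_basis_mul_eq_zero b t ?_)
  rcases hτ with ⟨hd, rfl⟩ | ⟨hd, hdim, hord⟩
  · exact forall_eq_zero_of_fermat hd hc y fun σ ↦ by
      have h := hBτ σ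
      have hcomp : σ.comp ((1 : L ≃ₐ[K] L) : L →ₐ[K] L) = σ := rfl
      rwa [hcomp, hcomp, AlgEquiv.one_apply] at h
  · exact forall_eq_zero_of_klein hd hdim τ hord hc y hF hBτ

theorem exists_smooth_linear_system_of_finrank_eq (τ : L ≃ₐ[K] L) (d r : ℕ) (hd2 : 2 ≤ d)
    (hrn : r ≤ n) (hdim : Module.finrank K L = n + 1)
    (hτ : ((d : K) ≠ 0 ∧ τ = 1) ∨
      ((d : K) = 0 ∧ ((n + 1 : ℕ) : K) ≠ 0 ∧ orderOf τ = n + 1)) :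
    ∃ F : Fin (r + 1) → MvPolynomial (Fin (n + 1)) K,
      LinearIndependent K F ∧ (∀ i, (F i).IsHomogeneous d) ∧
      ∀ a : Fin (r + 1) → K, a ≠ 0 → CutsOutSmoothHypersurface (∑ i, a i • F i) := by
  obtain ⟨e, rfl⟩ : ∃ e, d = e + 2 := ⟨d - 2, by omega⟩
  let b : Module.Basis (Fin (n + 1)) K L := Module.finBasisOfFinrankEq K L hdim
  let j : Fin (r + 1) → Fin (n + 1) := Fin.castLE (by omega)
  have hj : Function.Injective j := Fin.castLE_injective _
  have hsmooth : ∀ a : Fin (r + 1) → K, a ≠ 0 → CutsOutSmoothHypersurface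
      (∑ i, a i • coeffTrace (K := K) (twistedPower τ b e (b (j i)))) := fun a ha ↦ by
    have hsum : ∑ i, a i • coeffTrace (K := K) (twistedPower τ b e (b (j i))) =
        coeffTrace (K := K) (twistedPower τ b e (∑ i, a i • b (j i))) := by
      rw [sum_smul_coeffTrace]
      simp only [twistedPower, map_sum, Finset.sum_mul, Algebra.smul_def, map_mul, mul_assoc]
    rw [hsum]
    refine cutsOutSmoothHypersurface_coeffTrace_twistedPower b τ e (by rwa [hdim]) fun h ↦ ha ?_
    exact funext (Fintype.linearIndependent_iff.mp (b.linearIndependent.comp j hj) a h)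
  refine ⟨fun i ↦ coeffTrace (K := K) (twistedPower τ b e (b (j i))), ?_,
    fun i ↦ (isHomogeneous_twistedPower τ b e _).coeffTrace, hsmooth⟩
  rw [Fintype.linearIndependent_iff]
  intro a ha
  by_contra! h
  refine hsmooth a (fun h0 ↦ h.elim fun i hi ↦ hi (congrFun h0 i)) 1 one_ne_zero ?_
  rw [ha]
  simp

end TracedForms

section ConstantField

open IntermediateField in
theorem essFiniteType_of_subfield_closure_eq_top (k : Type*) {K : Type*} [Field k] [Field K]
    [Algebra k K] {S : Finset K} (hS : Subfield.closure (S : Set K) = ⊤) :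
    Algebra.EssFiniteType k K := by
  rw [← fg_top_iff]
  refine ⟨S, top_le_iff.mp fun x _ ↦ ?_⟩
  have hle : Subfield.closure (S : Set K) ≤ (adjoin k (S : Set K)).toSubfield :=
    Subfield.closure_le.mpr (subset_adjoin k _)
  exact hle (hS ▸ Subfield.mem_top x)

open IntermediateField algebraAdjoinAdjoin in
theorem linearIndependent_adjoin_of_algebraicIndependent {k K ι : Type*} [Field k] [Field K]
    [Algebra k K] {A : IntermediateField k K} [Algebra.IsAlgebraic k A] {s : Set K}
    (hs : AlgebraicIndependent k ((↑) : s → K)) {v : ι → A} (hv : LinearIndependent k v) :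
    LinearIndependent (adjoin k s) fun i ↦ (v i : K) := by
  rw [← LinearIndependent.iff_fractionRing (Algebra.adjoin k s)]
  have hsA : AlgebraicIndependent A ((↑) : s → K) := hs.extendScalars A
  rw [linearIndependent_iff']
  intro u g hg i hi
  have hlift : ∀ i, ∃ q : MvPolynomial s k, aeval ((↑) : s → K) q = (g i : K) := fun i ↦ by
    have h : (g i : K) ∈ Algebra.adjoin k (Set.range ((↑) : s → K)) := by
      rw [Subtype.range_coe]
      exact (g i).2
    rwa [Algebra.adjoin_range_eq_range_aeval] at h
  choose q hq using hlift
  have hzero : ∑ i ∈ u, C (v i) * map (algebraMap k A) (q i) = 0 := by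
    refine (injective_iff_map_eq_zero _).mp hsA _ ?_
    rw [← hg, map_sum]
    refine Finset.sum_congr rfl fun i _ ↦ ?_
    rw [map_mul, aeval_map_algebraMap, hq, aeval_C, mul_comm]
    rfl
  have hqi : q i = 0 := by
    ext m
    have hm := congrArg (coeff m) hzero
    simp only [coeff_sum, coeff_C_mul, coeff_map, coeff_zero] at hm
    refine linearIndependent_iff'.mp hv u (fun i ↦ coeff m (q i)) ?_ i hi
    rw [← hm]
    exact Finset.sum_congr rfl fun i _ ↦ by rw [Algebra.smul_def, mul_comm]
  refine Subtype.ext ?_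
  rw [← hq i, hqi, map_zero]
  rfl

open IntermediateField in
theorem finiteDimensional_algebraicClosure_of_essFiniteType (k K : Type*) [Field k] [Field K]
    [Algebra k K] [Algebra.EssFiniteType k K] : FiniteDimensional k (algebraicClosure k K) := by
  obtain ⟨s, hs⟩ := exists_isTranscendenceBasis k K
  have : Module.Finite (adjoin k s) K := by
    have : Algebra.EssFiniteType (adjoin k s) K := .of_comp k _ _
    have : Algebra.IsAlgebraic (adjoin k s) K := by
      have h := hs.isAlgebraic_field
      rwa [Subtype.range_coe] at h
    exact Algebra.finite_of_essFiniteType_of_isAlgebraic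
  have hrank : Module.rank k (algebraicClosure k K) ≤ (Module.finrank (adjoin k s) K : ℕ) := by
    refine rank_le fun u hu ↦ ?_
    have h := (linearIndependent_adjoin_of_algebraicIndependent hs.1 hu).fintype_card_le_finrank
    simpa using h
  exact Module.rank_lt_aleph0_iff.mp (hrank.trans_lt Cardinal.natCast_lt_aleph0)

theorem Polynomial.Monic.irreducible_map_of_isIntegrallyClosedIn {k K : Type*} [Field k] [Field K]
    [Algebra k K] (hk : ∀ x : K, IsIntegral k x → x ∈ (algebraMap k K).range)
    {f : Polynomial k} (hf : f.Monic) (hirr : Irreducible f) :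
    Irreducible (f.map (algebraMap k K)) := by
  have hlift : ∀ g : Polynomial K, g.Monic → g ∣ f.map (algebraMap k K) →
      ∃ g' : Polynomial k, g'.map (algebraMap k K) = g ∧ g'.natDegree = g.natDegree ∧ g'.Monic :=
    fun g hg hdvd ↦ Polynomial.lifts_and_natDegree_eq_and_monic
      ((Polynomial.lifts_iff_coeff_lifts _).mpr fun i ↦
        hk _ (Polynomial.isIntegral_coeff_of_dvd f g hf hg hdvd i)) hg
  rw [(hf.map _).irreducible_iff_natDegree]
  refine ⟨fun h ↦ hirr.ne_one (Polynomial.map_injective _ (algebraMap k K).injective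
    (by simpa using h)), fun g h hg hh hgh ↦ ?_⟩
  obtain ⟨g', rfl, hg', hgm⟩ := hlift g hg (hgh ▸ dvd_mul_right _ _)
  obtain ⟨h', rfl, hh', hhm⟩ := hlift h hh (hgh ▸ dvd_mul_left _ _)
  rw [← Polynomial.map_mul] at hgh
  rw [← hg', ← hh']
  exact (hf.irreducible_iff_natDegree.mp hirr).2 g' h' hgm hhm
    (Polynomial.map_injective _ (algebraMap k K).injective hgh)

theorem mem_range_of_isIntegral_algebraicClosure {k K : Type*} [Field k] [Field K] [Algebra k K]
    (x : K) (hx : IsIntegral (algebraicClosure k K) x) :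
    x ∈ (algebraMap (algebraicClosure k K) K).range := by
  have h : x ∈ algebraicClosure (algebraicClosure k K) K := mem_algebraicClosure_iff'.mpr hx
  rw [algebraicClosure.algebraicClosure_eq_bot] at h
  exact IntermediateField.mem_bot.mp h

open NumberField in
theorem NumberField.exists_monic_irreducible_natDegree_eq (k : Type*) [Field k] [NumberField k]
    {N : ℕ} (hN : N ≠ 0) : ∃ f : Polynomial k, f.Monic ∧ Irreducible f ∧ f.natDegree = N := by
  obtain ⟨P, hP⟩ := Ideal.exists_maximal (𝓞 k)
  have hP0 : P ≠ ⊥ := Ring.ne_bot_of_isMaximal_of_not_isField hP (RingOfIntegers.not_isField k)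
  obtain ⟨ϖ, hϖ, hϖ2⟩ := P.exists_mem_pow_notMem_pow_succ hP0 hP.ne_top 1
  rw [pow_one] at hϖ
  have hmonic : (Polynomial.X ^ N - Polynomial.C ϖ).Monic := Polynomial.monic_X_pow_sub_C ϖ hN
  have hdeg : (Polynomial.X ^ N - Polynomial.C ϖ).natDegree = N :=
    Polynomial.natDegree_X_pow_sub_C
  have heis : (Polynomial.X ^ N - Polynomial.C ϖ).IsEisensteinAt P :=
    { leading := by
        rw [hmonic.leadingCoeff]
        exact P.ne_top_iff_one.mp hP.ne_top
      mem := fun {i} hi ↦ by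
        rw [hdeg] at hi
        rw [Polynomial.coeff_sub, Polynomial.coeff_X_pow, if_neg hi.ne, zero_sub,
          Polynomial.coeff_C]
        split_ifs
        · exact P.neg_mem hϖ
        · exact P.neg_mem P.zero_mem
      notMem := by
        rw [Polynomial.coeff_sub, Polynomial.coeff_X_pow, if_neg (Ne.symm hN), zero_sub,
          Polynomial.coeff_C_zero]
        exact fun h ↦ hϖ2 ((Ideal.neg_mem_iff _).mp h) }
  have hirr := heis.irreducible hP.isPrime hmonic.isPrimitive (by rw [hdeg]; omega)
  exact ⟨_, hmonic.map (algebraMap (𝓞 k) k),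
    hmonic.irreducible_iff_irreducible_map_fraction_map.mp hirr, by
      rw [hmonic.natDegree_map, hdeg]⟩

open Polynomial in
theorem FiniteField.exists_monic_irreducible_natDegree_eq (k : Type*) [Field k] [Finite k]
    {N : ℕ} (hN : N ≠ 0) : ∃ f : Polynomial k, f.Monic ∧ Irreducible f ∧ f.natDegree = N := by
  obtain ⟨p, hp⟩ := CharP.exists k
  have : Fact p.Prime := ⟨CharP.char_is_prime k p⟩
  have : NeZero N := ⟨hN⟩
  obtain ⟨θ, hθ⟩ := Field.exists_primitive_element k (FiniteField.Extension k p N)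
  have hint : IsIntegral k θ := Algebra.IsIntegral.isIntegral θ
  refine ⟨minpoly k θ, minpoly.monic hint, minpoly.irreducible hint, ?_⟩
  rw [← IntermediateField.adjoin.finrank hint, hθ, IntermediateField.finrank_top',
    FiniteField.finrank_extension]

theorem finrank_adjoinRoot {k : Type*} [Field k] {f : Polynomial k} (hf : f.Monic) :
    Module.finrank k (AdjoinRoot f) = f.natDegree :=
  (AdjoinRoot.powerBasis hf.ne_zero).finrank.trans (AdjoinRoot.powerBasis_dim hf.ne_zero)

theorem isGalois_of_orderOf_eq_finrank {K L : Type*} [Field K] [Field L] [Algebra K L]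
    [FiniteDimensional K L] (τ : L ≃ₐ[K] L) (hτ : orderOf τ = Module.finrank K L) :
    IsGalois K L := by
  refine IsGalois.of_card_aut_eq_finrank K L (le_antisymm ?_ ?_)
  · rw [Nat.card_eq_fintype_card]
    exact AlgEquiv.card_le
  · rw [← hτ]
    exact orderOf_le_card

theorem exists_algEquiv_adjoinRoot_orderOf {k K : Type*} [Field k] [Field K] [Finite k]
    [Algebra k K] {f : Polynomial k} (hf : f.Monic) [Fact (Irreducible f)]
    [Fact (Irreducible (f.map (algebraMap k K)))] :
    ∃ τ : AdjoinRoot (f.map (algebraMap k K)) ≃ₐ[K] AdjoinRoot (f.map (algebraMap k K)),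
      orderOf τ = f.natDegree := by
  let g := f.map (algebraMap k K)
  let i : AdjoinRoot f →+* AdjoinRoot g := AdjoinRoot.map (algebraMap k K) f g dvd_rfl
  have hfinrank : Module.finrank k (AdjoinRoot f) = f.natDegree := finrank_adjoinRoot hf
  have hgrank : Module.finrank K (AdjoinRoot g) = f.natDegree := by
    rw [finrank_adjoinRoot (hf.map _), hf.natDegree_map]
  have : Module.Finite k (AdjoinRoot f) := (AdjoinRoot.powerBasis hf.ne_zero).finite
  have : Module.Finite K (AdjoinRoot g) := (AdjoinRoot.powerBasis (hf.map _).ne_zero).finite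
  have : Finite (AdjoinRoot f) := Module.finite_of_finite k
  have := Fintype.ofFinite k
  let φ := FiniteField.frobeniusAlgEquivOfAlgebraic k (AdjoinRoot f)
  have hof : ∀ a : k, i (AdjoinRoot.of f a) = AdjoinRoot.of g (algebraMap k K a) := fun a ↦
    AdjoinRoot.map_of _ _ _ _ _
  have hroot : i (AdjoinRoot.root f) = AdjoinRoot.root g := AdjoinRoot.map_root _ _ _ _
  have heval : g.eval₂ (Algebra.ofId K (AdjoinRoot g) : K →+* AdjoinRoot g)
      (i (φ (AdjoinRoot.root f))) = 0 := by
    have hcomp : (Algebra.ofId K (AdjoinRoot g) : K →+* AdjoinRoot g).comp (algebraMap k K) =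
        i.comp (algebraMap k (AdjoinRoot f)) := RingHom.ext fun a ↦ (hof a).symm
    rw [Polynomial.eval₂_map, hcomp, ← Polynomial.hom_eval₂, ← Polynomial.aeval_def,
      Polynomial.aeval_algHom_apply φ, AdjoinRoot.aeval_eq, AdjoinRoot.mk_self, map_zero, map_zero]
  let τ : AdjoinRoot g ≃ₐ[K] AdjoinRoot g :=
    (Algebra.IsAlgebraic.algEquivEquivAlgHom K (AdjoinRoot g)).symm
      (AdjoinRoot.liftAlgHom g (Algebra.ofId K _) (i (φ (AdjoinRoot.root f))) heval)
  have hτ : ∀ x, τ x =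
    AdjoinRoot.liftAlgHom g (Algebra.ofId K _) (i (φ (AdjoinRoot.root f))) heval x := fun _ ↦ rfl
  have hτi : ∀ x, τ (i x) = i (φ x) := fun x ↦ by
    induction x using AdjoinRoot.induction_on with
    | ih p =>
      induction p using Polynomial.induction_on' with
      | add p q hp hq => simp only [map_add, hp, hq]
      | monomial m a =>
        have hroot' : τ (AdjoinRoot.root g) = i (φ (AdjoinRoot.root f)) := by
          rw [hτ, AdjoinRoot.liftAlgHom_root]
        have hofτ : τ (AdjoinRoot.of g (algebraMap k K a)) = AdjoinRoot.of g (algebraMap k K a) :=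
          τ.commutes _
        have hofφ : φ (AdjoinRoot.of f a) = AdjoinRoot.of f a := φ.commutes a
        rw [← Polynomial.C_mul_X_pow_eq_monomial, map_mul, map_pow, AdjoinRoot.mk_C,
          AdjoinRoot.mk_X]
        simp only [map_mul, map_pow, hof, hroot, hroot', hofτ, hofφ]
  have hpow : ∀ (m : ℕ) x, (τ ^ m) (i x) = i ((φ ^ m) x) := by
    intro m
    induction m with
    | zero => exact fun x ↦ rfl
    | succ m ih =>
      intro x
      rw [pow_succ, pow_succ, AlgEquiv.mul_apply, AlgEquiv.mul_apply, hτi, ih]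
  refine ⟨τ, le_antisymm ?_ ?_⟩
  · rw [← hgrank]
    exact orderOf_le_card_univ.trans AlgEquiv.card_le
  · rw [← hfinrank, ← FiniteField.orderOf_frobeniusAlgEquivOfAlgebraic k (AdjoinRoot f)]
    refine Nat.le_of_dvd (orderOf_pos τ) (orderOf_dvd_of_pow_eq_one (AlgEquiv.ext fun x ↦ ?_))
    refine i.injective ?_
    rw [← hpow, pow_orderOf_eq_one]
    rfl

end ConstantField

/-- Over a finitely generated field `K` of characteristic `p ≥ 0`, if
`1 ≤ r ≤ n` and `p ∤ gcd(d, n+1)`, then there is a `K`-smooth linear system of projective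
dimension `r` of degree-`d` hypersurfaces in `ℙ^n`. -/
theorem exists_K_smooth_linear_system_of_finitely_generated
    {K : Type*} [Field K] (p : ℕ) [CharP K p]
    (hfg : ∃ S : Finset K, Subfield.closure (S : Set K) = ⊤)
    (n d r : ℕ) (hn : 2 ≤ n) (hd : 2 ≤ d) (hr1 : 1 ≤ r) (hrn : r ≤ n)
    (hp : ¬ p ∣ Nat.gcd d (n + 1)) :
    ∃ F : Fin (r + 1) → MvPolynomial (Fin (n + 1)) K,
      LinearIndependent K F ∧ (∀ i, (F i).IsHomogeneous d) ∧
      ∀ a : Fin (r + 1) → K, a ≠ 0 →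
        CutsOutSmoothHypersurface (∑ i, a i • F i) := by
  obtain ⟨S, hS⟩ := hfg
  rcases CharP.char_is_prime_or_zero K p with hprime | rfl
  · have : Fact p.Prime := ⟨hprime⟩
    let := ZMod.algebra K p
    have : Algebra.EssFiniteType (ZMod p) K := essFiniteType_of_subfield_closure_eq_top _ hS
    have := finiteDimensional_algebraicClosure_of_essFiniteType (ZMod p) K
    have : Finite (algebraicClosure (ZMod p) K) := Module.finite_of_finite (ZMod p)
    obtain ⟨f, hf, hirr, hdeg⟩ :=
      FiniteField.exists_monic_irreducible_natDegree_eq (algebraicClosure (ZMod p) K) n.succ_ne_zero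
    have : Fact (Irreducible f) := ⟨hirr⟩
    have : Fact (Irreducible (f.map (algebraMap (algebraicClosure (ZMod p) K) K))) :=
      ⟨hf.irreducible_map_of_isIntegrallyClosedIn mem_range_of_isIntegral_algebraicClosure hirr⟩
    obtain ⟨τ, hτ⟩ := exists_algEquiv_adjoinRoot_orderOf (K := K) hf
    have hdim : Module.finrank K
        (AdjoinRoot (f.map (algebraMap (algebraicClosure (ZMod p) K) K))) = n + 1 := by
      rw [finrank_adjoinRoot (hf.map _), hf.natDegree_map, hdeg]
    have := Module.finite_of_finrank_pos (n.succ_pos.trans_eq hdim.symm)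
    have := isGalois_of_orderOf_eq_finrank τ (by rw [hτ, hdim, hdeg])
    by_cases hpd : p ∣ d
    · refine exists_smooth_linear_system_of_finrank_eq τ d r hd hrn hdim
        (.inr ⟨(CharP.cast_eq_zero_iff K p d).mpr hpd, fun h ↦ hp ?_, hτ.trans hdeg⟩)
      exact Nat.dvd_gcd hpd ((CharP.cast_eq_zero_iff K p _).mp h)
    · exact exists_smooth_linear_system_of_finrank_eq 1 d r hd hrn hdim
        (.inl ⟨fun h ↦ hpd ((CharP.cast_eq_zero_iff K p d).mp h), rfl⟩)
  · have : CharZero K := CharP.charP_to_charZero K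
    have : Algebra.EssFiniteType ℚ K := essFiniteType_of_subfield_closure_eq_top _ hS
    have := finiteDimensional_algebraicClosure_of_essFiniteType ℚ K
    have : NumberField (algebraicClosure ℚ K) := ⟨⟩
    obtain ⟨f, hf, hirr, hdeg⟩ :=
      NumberField.exists_monic_irreducible_natDegree_eq (algebraicClosure ℚ K) n.succ_ne_zero
    have : Fact (Irreducible (f.map (algebraMap (algebraicClosure ℚ K) K))) :=
      ⟨hf.irreducible_map_of_isIntegrallyClosedIn mem_range_of_isIntegral_algebraicClosure hirr⟩
    have hdim : Module.finrank K
        (AdjoinRoot (f.map (algebraMap (algebraicClosure ℚ K) K))) = n + 1 := by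
      rw [finrank_adjoinRoot (hf.map _), hf.natDegree_map, hdeg]
    have := Module.finite_of_finrank_pos (n.succ_pos.trans_eq hdim.symm)
    exact exists_smooth_linear_system_of_finrank_eq
      (1 : AdjoinRoot (f.map (algebraMap (algebraicClosure ℚ K) K)) ≃ₐ[K] _) d r hd hrn hdim
      (.inl ⟨Nat.cast_ne_zero.mpr (by omega), rfl⟩)
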